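/- arXiv:1807.00940 — 5 statements merged into one kernel-verified Lean document; each statement's English description precedes it below -/
import Mathlib

section
/- Let →₀ and →₁ be two relations on a set A such that (1) →₀ is contained in →₁, (2) →₁ is confluent, and (3) every normal form of →₀ is a normal form of →₁. Then →₀ has unique normal forms with respect to conversion. -/
/-- `a` is a normal form of the relation `r`. -/
def IsNF {A : Type*} (r : A → A → Prop) (a : A) : Prop := ∀ b, ¬ r a b

/-- `r` is confluent (CR). -/
def Confluent {A : Type*} (r : A → A → Prop) : Prop :=
  ∀ a b c, Relation.ReflTransGen r a b → Relation.ReflTransGen r a c →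
    ∃ d, Relation.ReflTransGen r b d ∧ Relation.ReflTransGen r c d

/-- `r` has unique normal forms with respect to conversion. -/
def UNC {A : Type*} (r : A → A → Prop) : Prop :=
  ∀ a b, Relation.EqvGen r a b → IsNF r a → IsNF r b → a = b

/-- A normal form reduces only to itself. -/
theorem IsNF.eq_of_reflTransGen {A : Type*} {r : A → A → Prop} {a b : A} (ha : IsNF r a)
    (h : Relation.ReflTransGen r a b) : a = b := by
  rcases h.cases_head with h | ⟨c, hac, -⟩
  · exact h
  · exact absurd hac (ha c)

/-- Church–Rosser: convertible elements of a confluent relation have a common reduct. -/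
theorem Confluent.exists_common_reduct {A : Type*} {r : A → A → Prop} (hr : Confluent r)
    {a b : A} (h : Relation.EqvGen r a b) :
    ∃ d, Relation.ReflTransGen r a d ∧ Relation.ReflTransGen r b d := by
  induction h with
  | rel x y hxy => exact ⟨y, .single hxy, .refl⟩
  | refl x => exact ⟨x, .refl, .refl⟩
  | symm x y _ ih =>
    obtain ⟨d, hx, hy⟩ := ih
    exact ⟨d, hy, hx⟩
  | trans x y z _ _ ih₁ ih₂ =>
    obtain ⟨d, hxd, hyd⟩ := ih₁
    obtain ⟨e, hye, hze⟩ := ih₂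
    obtain ⟨f, hdf, hef⟩ := hr y d e hyd hye
    exact ⟨f, hxd.trans hdf, hze.trans hef⟩

theorem unc_of_confluent_approximation {A : Type*} (r₀ r₁ : A → A → Prop)
    (h1 : ∀ a b, r₀ a b → r₁ a b)
    (h2 : Confluent r₁)
    (h3 : ∀ a, IsNF r₀ a → IsNF r₁ a) :
    UNC r₀ := by
  intro a b hab ha hb
  obtain ⟨d, had, hbd⟩ := h2.exists_common_reduct (hab.mono h1)
  exact ((h3 a ha).eq_of_reflTransGen had).trans ((h3 b hb).eq_of_reflTransGen hbd).symm
end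

section
/- Let →_R and →_S be relations on a set A such that (1) →_R is contained in →_S and →_S is contained in the conversion (equivalence closure) of →_R, and (2) every normal form of →_R is a normal form of →_S. If →_S is confluent, then →_R has unique normal forms with respect to conversion. -/
/-- Convertible elements of a confluent relation have a common reduct. -/
theorem Confluent.join_of_eqvGen {A : Type*} {r : A → A → Prop} (hr : Confluent r) {a b : A}
    (h : Relation.EqvGen r a b) : Relation.Join (Relation.ReflTransGen r) a b := by
  induction h with
  | rel a b hab => exact ⟨b, .single hab, .refl⟩
  | refl a => exact ⟨a, .refl, .refl⟩
  | symm a b _ ih =>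
    obtain ⟨d, had, hbd⟩ := ih
    exact ⟨d, hbd, had⟩
  | trans a b c _ _ ihab ihbc =>
    obtain ⟨d, had, hbd⟩ := ihab
    obtain ⟨e, hbe, hce⟩ := ihbc
    obtain ⟨f, hdf, hef⟩ := hr b d e hbd hbe
    exact ⟨f, had.trans hdf, hce.trans hef⟩

theorem unc_of_confluent_sandwich {A : Type*} (rR rS : A → A → Prop)
    (h1 : (∀ a b, rR a b → rS a b) ∧ (∀ a b, rS a b → Relation.EqvGen rR a b))
    (h2 : ∀ a, IsNF rR a → IsNF rS a)
    (hCR : Confluent rS) :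
    UNC rR := by
  intro a b hab ha hb
  obtain ⟨d, had, hbd⟩ := hCR.join_of_eqvGen (hab.mono h1.1)
  exact ((h2 a ha).eq_of_reflTransGen had).trans ((h2 b hb).eq_of_reflTransGen hbd).symm
end

section
/- Let r and r' be relations on a set A such that r is contained in r', r' is contained in the conversion (equivalence closure) of r, and every normal form of r is a normal form of r'. Then r has unique normal forms with respect to conversion if and only if r' has unique normal forms with respect to conversion. -/
theorem eqvGen_of_forall_eqvGen {A : Type*} {r s : A → A → Prop}
    (h : ∀ a b, r a b → Relation.EqvGen s a b) {a b : A} (hab : Relation.EqvGen r a b) :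
    Relation.EqvGen s a b := by
  induction hab with
  | rel a b hr => exact h a b hr
  | refl a => exact .refl a
  | symm a b _ ih => exact .symm _ _ ih
  | trans a b c _ _ ih₁ ih₂ => exact .trans _ _ _ ih₁ ih₂

theorem unc_iff_of_sandwich {A : Type*} (r r' : A → A → Prop)
    (h1 : ∀ a b, r a b → r' a b)
    (h2 : ∀ a b, r' a b → Relation.EqvGen r a b)
    (h3 : ∀ a, IsNF r a → IsNF r' a) :
    UNC r ↔ UNC r' := by
  have hconv : ∀ a b, Relation.EqvGen r a b ↔ Relation.EqvGen r' a b := fun a b =>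
    ⟨Relation.EqvGen.mono h1 a b, eqvGen_of_forall_eqvGen h2⟩
  have hnf : ∀ a, IsNF r a ↔ IsNF r' a := fun a =>
    ⟨h3 a, fun h b hr => h b (h1 a b hr)⟩
  simp only [UNC, hconv, hnf]
end

section
/- Let r be a relation on a set A, and let a, b ∈ A with r a b and b not a normal form of r. Define the relation r' by: r' x y holds if and only if (r x y and (x, y) ≠ (a, b)) or (x, y) = (a, a) or (x, y) = (b, a). Then r has unique normal forms with respect to conversion if and only if r' has unique normal forms with respect to conversion. -/
theorem unc_congr {A : Type*} {r s : A → A → Prop}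
    (hrs : ∀ x y, r x y → Relation.EqvGen s x y) (hsr : ∀ x y, s x y → Relation.EqvGen r x y)
    (hnf : ∀ x, IsNF r x ↔ IsNF s x) : UNC r ↔ UNC s := by
  have lift {p q : A → A → Prop} (hpq : ∀ x y, p x y → Relation.EqvGen q x y) {x y : A}
      (h : Relation.EqvGen p x y) : Relation.EqvGen q x y := by
    induction h with
    | rel x y h => exact hpq x y h
    | refl x => exact .refl x
    | symm x y _ ih => exact .symm _ _ ih
    | trans x y z _ _ ih₁ ih₂ => exact .trans _ _ _ ih₁ ih₂
  exact ⟨fun h x y hxy hx hy => h x y (lift hsr hxy) ((hnf x).2 hx) ((hnf y).2 hy),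
    fun h x y hxy hx hy => h x y (lift hrs hxy) ((hnf x).1 hx) ((hnf y).1 hy)⟩

theorem unc_iff_rule_reversing {A : Type*} (r : A → A → Prop) (a b : A)
    (hab : r a b) (hb : ¬ IsNF r b) :
    UNC r ↔
      UNC (fun x y => (r x y ∧ (x, y) ≠ (a, b)) ∨ (x, y) = (a, a) ∨ (x, y) = (b, a)) := by
  refine unc_congr (fun x y h => ?_) (fun x y h => ?_)
    (fun x => ⟨fun hx y h => ?_, fun hx y h => ?_⟩)
  · by_cases hxy : (x, y) = (a, b)
    · obtain ⟨rfl, rfl⟩ := Prod.mk.inj hxy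
      exact .symm _ _ (.rel _ _ (.inr (.inr rfl)))
    · exact .rel _ _ (.inl ⟨h, hxy⟩)
  · obtain ⟨h, -⟩ | h | h := h
    · exact .rel _ _ h
    · obtain ⟨rfl, rfl⟩ := Prod.mk.inj h
      exact .refl _
    · obtain ⟨rfl, rfl⟩ := Prod.mk.inj h
      exact .symm _ _ (.rel _ _ hab)
  · obtain ⟨h, -⟩ | h | h := h
    · exact hx y h
    · obtain ⟨rfl, rfl⟩ := Prod.mk.inj h
      exact hx b hab
    · obtain ⟨rfl, rfl⟩ := Prod.mk.inj h
      exact hb hx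
  · by_cases hxy : (x, y) = (a, b)
    · obtain ⟨rfl, rfl⟩ := Prod.mk.inj hxy
      exact hx x (.inr (.inl rfl))
    · exact hx y (.inl ⟨h, hxy⟩)
end

section
/- Let r be a relation on a set A and let a ∈ A with r a a. Define the relation r' by: r' x y holds if and only if r x y and (x, y) ≠ (a, a). Assume that a is not a normal form of r'. Then r has unique normal forms with respect to conversion if and only if r' has unique normal forms with respect to conversion. -/
/-- Removing the loop at `a` does not change the conversion relation. -/
theorem eqvGen_remove_loop {A : Type*} (r : A → A → Prop) (a : A) :
    Relation.EqvGen (fun x y => r x y ∧ (x, y) ≠ (a, a)) = Relation.EqvGen r := by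
  ext x y
  constructor
  · exact Relation.EqvGen.mono (fun _ _ h => h.1) x y
  · intro h
    induction h with
    | rel x y h =>
      by_cases hxy : (x, y) = (a, a)
      · obtain ⟨rfl, rfl⟩ := Prod.mk.inj hxy
        exact .refl _
      · exact .rel _ _ ⟨h, hxy⟩
    | refl x => exact .refl x
    | symm x y _ ih => exact .symm _ _ ih
    | trans x y z _ _ ih₁ ih₂ => exact .trans _ _ _ ih₁ ih₂

/-- Removing the loop at `a` does not change the normal forms if `a` remains reducible. -/
theorem isNF_remove_loop_iff {A : Type*} (r : A → A → Prop) (a : A)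
    (ha : ¬ IsNF (fun x y => r x y ∧ (x, y) ≠ (a, a)) a) (x : A) :
    IsNF (fun x y => r x y ∧ (x, y) ≠ (a, a)) x ↔ IsNF r x := by
  refine ⟨fun h y hxy => ?_, fun h y hxy => h y hxy.1⟩
  refine h y ⟨hxy, fun he => ha ?_⟩
  obtain ⟨rfl, rfl⟩ := Prod.mk.inj he
  exact h

theorem unc_iff_remove_trivial_loop {A : Type*} (r : A → A → Prop) (a : A)
    (haa : r a a)
    (ha : ¬ IsNF (fun x y => r x y ∧ (x, y) ≠ (a, a)) a) :
    UNC r ↔ UNC (fun x y => r x y ∧ (x, y) ≠ (a, a)) := by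
  simp only [UNC, eqvGen_remove_loop, isNF_remove_loop_iff r a ha]
end
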